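/- Let R be a commutative ring and M an R-module. Then fPD(R(+)M) = sup{ min{ grade_R(𝔪, R), grade_R(𝔪, M) } : 𝔪 ∈ Max(R) }, and consequently fPD(R(+)M) ≤ fPD(R). -/

import Mathlib

open CategoryTheory

universe u

/-- `M` has a projective resolution `0 → P_n → ⋯ → P_0 → M → 0` of length at most `n`
(the `P_i` projective, not necessarily finitely generated). -/
def HasProjResLE (R : Type u) [CommRing R] :
    ℕ → ∀ (M : Type u) [AddCommGroup M] [Module R M], Prop
  | 0, M, _, _ => Module.Projective R M
  | n + 1, M, _, _ => ∃ (P : Type u) (_ : AddCommGroup P) (_ : Module R P) (f : P →ₗ[R] M),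
      Module.Projective R P ∧ Function.Surjective f ∧ HasProjResLE R n (LinearMap.ker f)

/-- `M` has a finite projective resolution `0 → P_n → ⋯ → P_0 → M → 0` of length `n`
with each `P_i` finitely generated projective. -/
def HasFPRLen (R : Type u) [CommRing R] :
    ℕ → ∀ (M : Type u) [AddCommGroup M] [Module R M], Prop
  | 0, M, _, _ => Module.Finite R M ∧ Module.Projective R M
  | n + 1, M, _, _ => ∃ (P : Type u) (_ : AddCommGroup P) (_ : Module R P) (f : P →ₗ[R] M),
      Module.Finite R P ∧ Module.Projective R P ∧ Function.Surjective f ∧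
        HasFPRLen R n (LinearMap.ker f)

/-- `M` has a finite projective resolution by finitely generated projectives. -/
def HasFPR (R : Type u) [CommRing R] (M : Type u) [AddCommGroup M] [Module R M] : Prop :=
  ∃ n, HasFPRLen R n M

/-- The projective dimension of `M`, as an element of `ℕ∞` (with `⊤` meaning no finite
projective resolution exists). -/
noncomputable def projDim (R : Type u) [CommRing R] (M : Type u) [AddCommGroup M]
    [Module R M] : ℕ∞ :=
  sInf {n : ℕ∞ | ∃ m : ℕ, n = m ∧ HasProjResLE R m M}

/-- The small finitistic dimension `fPD R`: the supremum, in `ℕ∞`, of the projective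
dimensions of `R`-modules having a finite projective resolution. -/
noncomputable def fPD (R : Type u) [CommRing R] : ℕ∞ :=
  ⨆ (M : ModuleCat.{u} R) (_ : HasFPR R M), projDim R M

/-- `Ext_R^n(M, N)` as an `R`-module (object of `ModuleCat R`). -/
noncomputable def ExtMod (R : Type u) [CommRing R] (M N : Type u) [AddCommGroup M] [Module R M]
    [AddCommGroup N] [Module R N] (n : ℕ) : ModuleCat.{u} R :=
  ((Ext R (ModuleCat.{u} R) n).obj (Opposite.op (ModuleCat.of R M))).obj (ModuleCat.of R N)

/-- The Ext-grade of an ideal `I` on `M`: `inf { p | Ext_R^p(R/I, M) ≠ 0 } ∈ ℕ∞`. -/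
noncomputable def extGrade (R : Type u) [CommRing R] (I : Ideal R) (M : Type u) [AddCommGroup M]
    [Module R M] : ℕ∞ :=
  sInf {n : ℕ∞ | ∃ p : ℕ, n = p ∧ ¬ Subsingleton (ExtMod R (R ⧸ I) M p)}

/-- The grade of an arbitrary ideal `J` on `M`: the supremum of the Ext-grades of the
finitely generated ideals contained in `J`. -/
noncomputable def idealGrade (R : Type u) [CommRing R] (J : Ideal R) (M : Type u)
    [AddCommGroup M] [Module R M] : ℕ∞ :=
  ⨆ (I : Ideal R) (_ : I.FG) (_ : I ≤ J), extGrade R I M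

/-- For a module over a commutative ring, the canonical right module structure. -/
noncomputable local instance moduleOpOfModule (R : Type u) [CommRing R] (M : Type u)
    [AddCommGroup M] [Module R M] : Module Rᵐᵒᵖ M :=
  Module.compHom M ((RingHom.id R).fromOpposite mul_comm)

local instance isCentralScalarOfModule (R : Type u) [CommRing R] (M : Type u)
    [AddCommGroup M] [Module R M] : IsCentralScalar R M :=
  ⟨fun _ _ => rfl⟩


section Bridge

variable {R : Type u} [CommRing R]

lemma linearYonedaObj_exactAt_zero_iff {X : ModuleCat.{u} R} (P : ProjectiveResolution X)
    (Y : ModuleCat.{u} R) :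
    (P.complex.linearYonedaObj R Y).ExactAt 0 ↔
      ∀ f : P.complex.X 0 ⟶ Y, P.complex.d 1 0 ≫ f = 0 → f = 0 := by
  rw [HomologicalComplex.exactAt_iff' _ 0 0 1 (by simp) (by simp),
    ShortComplex.moduleCat_exact_iff]
  refine ⟨fun h f hf => ?_, fun h f hf => ⟨0, ?_⟩⟩
  · obtain ⟨g, hg⟩ := h f hf
    rw [← hg]
    change P.complex.d 0 0 ≫ (show P.complex.X 0 ⟶ Y from g) = 0
    rw [P.complex.shape 0 0 (by simp), Limits.zero_comp]
  · rw [map_zero]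
    exact (h f hf).symm

lemma linearYonedaObj_exactAt_succ_iff {X : ModuleCat.{u} R} (P : ProjectiveResolution X)
    (Y : ModuleCat.{u} R) (n : ℕ) :
    (P.complex.linearYonedaObj R Y).ExactAt (n + 1) ↔
      ∀ f : P.complex.X (n + 1) ⟶ Y, P.complex.d (n + 2) (n + 1) ≫ f = 0 →
        ∃ g : P.complex.X n ⟶ Y, P.complex.d (n + 1) n ≫ g = f := by
  rw [HomologicalComplex.exactAt_iff' _ n (n + 1) (n + 2) (by simp) (by simp),
    ShortComplex.moduleCat_exact_iff]
  exact Iff.rfl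

lemma subsingleton_extMod_iff (A N : Type u) [AddCommGroup A] [Module R A]
    [AddCommGroup N] [Module R N] (n : ℕ) :
    Subsingleton (ExtMod R A N n) ↔
      Subsingleton (Abelian.Ext.{u} (ModuleCat.of R A) (ModuleCat.of R N) n) := by
  let P := projectiveResolution (ModuleCat.of R A)
  have h : Subsingleton (ExtMod R A N n) ↔
      (P.complex.linearYonedaObj R (ModuleCat.of R N)).ExactAt n := by
    rw [HomologicalComplex.exactAt_iff_isZero_homology, ← ModuleCat.isZero_iff_subsingleton]
    exact (P.isoExt n (ModuleCat.of R N)).isZero_iff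
  rw [h]
  cases n with
  | zero =>
    rw [linearYonedaObj_exactAt_zero_iff, Abelian.Ext.addEquiv₀.toEquiv.subsingleton_congr]
    have hex := P.exact₀
    constructor
    · intro H
      have key (a b : ((ChainComplex.single₀ (ModuleCat R)).obj (ModuleCat.of R A)).X 0 ⟶
          ModuleCat.of R N) : a = b := by
        rw [← cancel_epi (P.π.f 0), ← sub_eq_zero, ← Preadditive.comp_sub]
        exact H _ (by rw [← Category.assoc, P.complex_d_comp_π_f_zero, Limits.zero_comp])
      exact ⟨key⟩
    · intro H f hf
      have : f = P.π.f 0 ≫ hex.desc f hf := (hex.g_desc f hf).symm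
      rw [this, H.elim (hex.desc f hf) 0]
      exact Limits.comp_zero
  | succ n =>
    rw [linearYonedaObj_exactAt_succ_iff]
    constructor
    · refine fun H => subsingleton_of_forall_eq 0 fun e => ?_
      obtain ⟨f, hf, rfl⟩ := P.extMk_surjective e (n + 2) rfl
      exact (P.extMk_eq_zero_iff f (n + 2) rfl hf n rfl).2 (H f hf)
    · intro H f hf
      exact (P.extMk_eq_zero_iff f (n + 2) rfl hf n rfl).1 (Subsingleton.elim _ _)

end Bridge

section ExtVanishing

variable {R : Type u} [CommRing R] {A N N₁ N₂ N₃ : Type u}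
  [AddCommGroup A] [Module R A] [AddCommGroup N] [Module R N]
  [AddCommGroup N₁] [Module R N₁] [AddCommGroup N₂] [Module R N₂] [AddCommGroup N₃] [Module R N₃]

/-- The group `Ext_R^k(A, N)` of two modules over a commutative ring. -/
abbrev ModExt (R : Type u) [CommRing R] (A N : Type u) [AddCommGroup A] [Module R A]
    [AddCommGroup N] [Module R N] (k : ℕ) : Type u :=
  Abelian.Ext.{u} (ModuleCat.of R A) (ModuleCat.of R N) k

variable (A) in
/-- The map `Ext_R^k(A, N₁) → Ext_R^k(A, N₂)` induced by a linear map `N₁ → N₂`. -/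
noncomputable def extMap (k : ℕ) (f : N₁ →ₗ[R] N₂) : ModExt R A N₁ k →+ ModExt R A N₂ k :=
  (Abelian.Ext.mk₀ (ModuleCat.ofHom f)).postcomp (ModuleCat.of R A) (add_zero k)

lemma extMap_apply (k : ℕ) (f : N₁ →ₗ[R] N₂) (e : ModExt R A N₁ k) :
    extMap A k f e = e.comp (Abelian.Ext.mk₀ (ModuleCat.ofHom f)) (add_zero k) := rfl

lemma extMap_id (k : ℕ) (e : ModExt R A N k) : extMap A k (LinearMap.id (R := R)) e = e := by
  rw [extMap_apply]
  exact Abelian.Ext.comp_mk₀_id e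

lemma extMap_comp (k : ℕ) (f : N₁ →ₗ[R] N₂) (g : N₂ →ₗ[R] N₃) (e : ModExt R A N₁ k) :
    extMap A k (g ∘ₗ f) e = extMap A k g (extMap A k f e) := by
  simp only [extMap_apply, ModuleCat.ofHom_comp, ← Abelian.Ext.mk₀_comp_mk₀]
  rw [Abelian.Ext.comp_assoc_of_third_deg_zero]

lemma extMap_add (k : ℕ) (f g : N₁ →ₗ[R] N₂) (e : ModExt R A N₁ k) :
    extMap A k (f + g) e = extMap A k f e + extMap A k g e := by
  simp only [extMap_apply, ModuleCat.ofHom_add, Abelian.Ext.mk₀_add, Abelian.Ext.comp_add]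

lemma extMap_zero (k : ℕ) (e : ModExt R A N₁ k) :
    extMap A k (0 : N₁ →ₗ[R] N₂) e = 0 := by
  simpa using extMap_add k (0 : N₁ →ₗ[R] N₂) 0 e

lemma extMap_sum {ι : Type*} (s : Finset ι) (k : ℕ) (f : ι → N₁ →ₗ[R] N₂) (e : ModExt R A N₁ k) :
    extMap A k (∑ i ∈ s, f i) e = ∑ i ∈ s, extMap A k (f i) e := by
  classical
  induction s using Finset.induction_on with
  | empty => simpa using extMap_zero k e
  | insert a s ha ih => rw [Finset.sum_insert ha, Finset.sum_insert ha, extMap_add, ih]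

lemma extMap_smul_id (k : ℕ) (r : R) (e : ModExt R A N k) :
    extMap A k (r • LinearMap.id) e = r • e := by
  rw [Abelian.Ext.smul_eq_comp_mk₀, extMap_apply]
  rfl

lemma smul_ext_quotient_eq_zero (I : Ideal R) (k : ℕ) {r : R} (hr : r ∈ I)
    (e : ModExt R (R ⧸ I) N k) : r • e = 0 := by
  have h : (r • 𝟙 (ModuleCat.of R (R ⧸ I))) = 0 := by
    ext
    exact Ideal.Quotient.eq_zero_iff_mem.2 (by simpa using hr)
  have h2 : r • e = (Abelian.Ext.mk₀ (r • 𝟙 (ModuleCat.of R (R ⧸ I)))).comp e (zero_add k) := by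
    simp [Abelian.Ext.mk₀_smul]
  rw [h2, h, Abelian.Ext.mk₀_zero, Abelian.Ext.zero_comp]

/-- `Ext_R^k(A, N)` vanishes as soon as the identity of `N` is a finite sum of maps factoring
through modules `N'` with `Ext_R^k(A, N') = 0`. -/
lemma subsingleton_ext_of_sum_comp_eq_id {ι : Type*} [Fintype ι] (k : ℕ) (N' : ι → Type u)
    [∀ i, AddCommGroup (N' i)] [∀ i, Module R (N' i)] (f : ∀ i, N →ₗ[R] N' i)
    (g : ∀ i, N' i →ₗ[R] N) (h : ∑ i, g i ∘ₗ f i = LinearMap.id)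
    (hN : ∀ i, Subsingleton (ModExt R A (N' i) k)) : Subsingleton (ModExt R A N k) := by
  refine subsingleton_of_forall_eq 0 fun e => ?_
  rw [← extMap_id k e, ← h, extMap_sum]
  refine Finset.sum_eq_zero fun i _ => ?_
  rw [extMap_comp, Subsingleton.elim (extMap A k (f i) e) 0, map_zero]

lemma subsingleton_ext_of_linearEquiv (k : ℕ) (f : N₁ ≃ₗ[R] N₂)
    (h : Subsingleton (ModExt R A N₁ k)) : Subsingleton (ModExt R A N₂ k) :=
  subsingleton_ext_of_sum_comp_eq_id (ι := Unit) k (fun _ => N₁) (fun _ => f.symm.toLinearMap)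
    (fun _ => f.toLinearMap) (by simp) fun _ => h

lemma subsingleton_ext_pi {ι : Type} [Fintype ι] (k : ℕ) (h : Subsingleton (ModExt R A N k)) :
    Subsingleton (ModExt R A (ι → N) k) := by
  classical
  refine subsingleton_ext_of_sum_comp_eq_id k (fun _ : ι => N) (fun i => LinearMap.proj i)
    (fun i => LinearMap.single R (fun _ => N) i) ?_ fun _ => h
  ext i x j
  simp [Pi.single_apply]

lemma subsingleton_ext_zero_iff :
    Subsingleton (ModExt R A N 0) ↔ Subsingleton (A →ₗ[R] N) :=
  (Abelian.Ext.addEquiv₀.trans ModuleCat.homAddEquiv).toEquiv.subsingleton_congr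

variable {f : N₁ →ₗ[R] N₂} {g : N₂ →ₗ[R] N₃}

/-- The short exact sequence in `ModuleCat R` attached to an exact sequence of modules. -/
lemma shortExact_moduleCatMk (hf : Function.Injective f) (hg : Function.Surjective g)
    (hfg : Function.Exact f g) :
    (ShortComplex.moduleCatMk f g hfg.linearMap_comp_eq_zero).ShortExact :=
  ModuleCat.shortComplex_shortExact _ hfg hf hg

lemma subsingleton_ext_right (hf : Function.Injective f) (hg : Function.Surjective g)
    (hfg : Function.Exact f g) (k : ℕ) (h₂ : Subsingleton (ModExt R A N₂ k))
    (h₁ : Subsingleton (ModExt R A N₁ (k + 1))) : Subsingleton (ModExt R A N₃ k) := by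
  have hS := shortExact_moduleCatMk hf hg hfg
  refine subsingleton_of_forall_eq 0 fun e => ?_
  obtain ⟨e', he'⟩ := Abelian.Ext.covariant_sequence_exact₃ (ModuleCat.of R A) hS e rfl
    (h₁.elim _ _)
  rw [← he', h₂.elim e' 0]
  exact Abelian.Ext.zero_comp ..

lemma extMap_injective_succ (hf : Function.Injective f) (hg : Function.Surjective g)
    (hfg : Function.Exact f g) (k : ℕ) (h₃ : Subsingleton (ModExt R A N₃ k)) :
    Function.Injective (extMap A (k + 1) f) := by
  have hS := shortExact_moduleCatMk hf hg hfg
  rw [injective_iff_map_eq_zero]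
  intro e he
  obtain ⟨e', he'⟩ := Abelian.Ext.covariant_sequence_exact₁ (ModuleCat.of R A) hS e he rfl
  rw [← he', h₃.elim e' 0]
  exact Abelian.Ext.zero_comp ..

lemma extMap_injective_zero (hf : Function.Injective f) :
    Function.Injective (extMap A 0 f) := by
  have : Mono (ModuleCat.ofHom f) := (ModuleCat.mono_iff_injective _).2 hf
  exact Abelian.Ext.postcomp_mk₀_injective_of_mono (ModuleCat.of R A) (ModuleCat.ofHom f)

/-- For `0 → N₁ → N₂ → N₃ → 0` exact, `Ext^k(A, N₁) → Ext^k(A, N₂)` is injective if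
`Ext^j(A, N₃) = 0` for all `j < k`. -/
lemma extMap_injective (hf : Function.Injective f) (hg : Function.Surjective g)
    (hfg : Function.Exact f g) (k : ℕ) (h₃ : ∀ j < k, Subsingleton (ModExt R A N₃ j)) :
    Function.Injective (extMap A k f) := by
  cases k with
  | zero => exact extMap_injective_zero hf
  | succ k => exact extMap_injective_succ hf hg hfg k (h₃ k k.lt_succ_self)

end ExtVanishing

section Complex

variable {R : Type u} [CommRing R] {ι : Type}

/-- For a family `x : ι → R`, the complex with terms `(Fin k → ι) → N` and differential
`(d c)(i₀, …, i_k) = ∑ j, (-1)^j x_{i_j} c(i₀, …, î_j, …, i_k)`, defined by recursion on `k`.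
It is a non-alternating version of the Koszul cochain complex of `x` on `N`. -/
def barD (x : ι → R) (N : Type u) [AddCommGroup N] [Module R N] :
    ∀ k : ℕ, ((Fin k → ι) → N) →ₗ[R] ((Fin (k + 1) → ι) → N)
  | 0 => LinearMap.pi fun i => x (i 0) • LinearMap.proj (Fin.tail i)
  | k + 1 => LinearMap.pi fun i => x (i 0) • LinearMap.proj (Fin.tail i) -
      LinearMap.proj (Fin.tail i) ∘ₗ barD x N k ∘ₗ
        LinearMap.funLeft R N fun j : Fin k → ι => (Fin.cons (i 0) j : Fin (k + 1) → ι)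

variable {N N' : Type u} [AddCommGroup N] [Module R N] [AddCommGroup N'] [Module R N']

lemma barD_zero_apply (x : ι → R) (c : (Fin 0 → ι) → N) (i : Fin 1 → ι) :
    barD x N 0 c i = x (i 0) • c (Fin.tail i) := rfl

lemma barD_succ_apply (x : ι → R) (k : ℕ) (c : (Fin (k + 1) → ι) → N) (i : Fin (k + 2) → ι) :
    barD x N (k + 1) c i =
      x (i 0) • c (Fin.tail i) - barD x N k (fun j => c (Fin.cons (i 0) j)) (Fin.tail i) := rfl

lemma barD_succ_cons (x : ι → R) (k : ℕ) (c : (Fin (k + 1) → ι) → N) (a : ι) :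
    (fun i => barD x N (k + 1) c (Fin.cons a i)) =
      x a • c - barD x N k (fun j => c (Fin.cons a j)) := by
  ext i
  simp [barD_succ_apply]

lemma barD_zero_cons (x : ι → R) (c : (Fin 0 → ι) → N) (a : ι) :
    (fun i => barD x N 0 c (Fin.cons a i)) = x a • c := by
  ext i
  simp [barD_zero_apply]

lemma barD_barD (x : ι → R) (k : ℕ) (c : (Fin k → ι) → N) :
    barD x N (k + 1) (barD x N k c) = 0 := by
  induction k with
  | zero =>
    ext i
    rw [barD_succ_apply, barD_zero_cons, map_smul]
    simp
  | succ k ih =>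
    ext i
    rw [barD_succ_apply, barD_succ_cons, map_sub, ih, map_smul]
    simp

lemma barD_comp (x : ι → R) (f : N →ₗ[R] N') (k : ℕ) (c : (Fin k → ι) → N) :
    barD x N' k (f ∘ c) = f ∘ barD x N k c := by
  induction k with
  | zero => ext i; simp [barD_zero_apply]
  | succ k ih =>
    ext i
    simp only [barD_succ_apply, Function.comp_apply, map_sub, map_smul]
    exact congrArg _ (congrFun (ih _) _)

lemma barD_algebraMap {S : Type u} [CommRing S] [Algebra R S] (x : ι → R) (k : ℕ)
    (c : (Fin k → ι) → S) :
    barD (fun i => algebraMap R S (x i)) S k c = barD x S k c := by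
  induction k with
  | zero => ext i; simp [barD_zero_apply, Algebra.smul_def]
  | succ k ih =>
    ext i
    simp only [barD_succ_apply, ih, smul_eq_mul, Algebra.smul_def]

/-- The complex `barD x N` is exact in degree `k`. -/
def BarExactAt (x : ι → R) (N : Type u) [AddCommGroup N] [Module R N] : ℕ → Prop
  | 0 => ∀ c, barD x N 0 c = 0 → c = 0
  | k + 1 => ∀ c, barD x N (k + 1) c = 0 → ∃ b, barD x N k b = c

lemma smul_mem_range_barD (x : ι → R) (k : ℕ) (c : (Fin (k + 1) → ι) → N)
    (hc : barD x N (k + 1) c = 0) {r : R} (hr : r ∈ Ideal.span (Set.range x)) :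
    r • c ∈ LinearMap.range (barD x N k) := by
  suffices h : Ideal.span (Set.range x) ≤
      (LinearMap.range (barD x N k)).comap (LinearMap.toSpanSingleton R _ c) from h hr
  rw [Ideal.span_le]
  rintro _ ⟨a, rfl⟩
  refine ⟨fun j => c (Fin.cons a j), ?_⟩
  have h := barD_succ_cons x k c a
  rw [hc] at h
  exact (sub_eq_zero.1 h.symm).symm

lemma smul_eq_zero_of_barD_eq_zero (x : ι → R) (c : (Fin 0 → ι) → N)
    (hc : barD x N 0 c = 0) {r : R} (hr : r ∈ Ideal.span (Set.range x)) : r • c = 0 := by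
  suffices h : Ideal.span (Set.range x) ≤
      LinearMap.ker (LinearMap.toSpanSingleton R _ c) from h hr
  rw [Ideal.span_le]
  rintro _ ⟨a, rfl⟩
  have h := barD_zero_cons x c a
  rw [hc] at h
  exact h.symm

/-- If every linear map `R/I → N` vanishes, then `N` has no nonzero element killed by `I`. -/
lemma eq_zero_of_forall_smul_eq_zero {I : Ideal R} (h : Subsingleton (ModExt R (R ⧸ I) N 0))
    (c : N) (hc : ∀ r ∈ I, r • c = 0) : c = 0 := by
  rw [subsingleton_ext_zero_iff] at h
  let f : R ⧸ I →ₗ[R] N := Submodule.liftQ I (LinearMap.toSpanSingleton R N c) hc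
  have hf : f (Submodule.Quotient.mk 1) = c :=
    (Submodule.liftQ_apply I _ 1).trans (one_smul R c)
  rw [← hf, h.elim f 0, LinearMap.zero_apply]

/-- If `Ext_R^i(R/I, N) = 0` for `i < n`, where `I` is contained in the ideal generated by `x`,
then the complex `barD x N` is exact in degrees less than `n`. -/
lemma barExactAt_of_ext [Fintype ι] (x : ι → R) {I : Ideal R} (hI : I ≤ Ideal.span (Set.range x))
    (n : ℕ) (hN : ∀ i < n, Subsingleton (ModExt R (R ⧸ I) N i)) (k : ℕ) (hk : k < n) :
    BarExactAt x N k ∧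
      ∀ i, i + k < n → Subsingleton (ModExt R (R ⧸ I) (LinearMap.range (barD x N k)) i) := by
  have hC (k i : ℕ) (hi : i < n) : Subsingleton (ModExt R (R ⧸ I) ((Fin k → ι) → N) i) := by
    classical exact subsingleton_ext_pi i (hN i hi)
  induction k with
  | zero =>
    have hex : BarExactAt x N 0 := fun c hc =>
      eq_zero_of_forall_smul_eq_zero (hC 0 0 hk) c fun r hr =>
        smul_eq_zero_of_barD_eq_zero x c hc (hI hr)
    exact ⟨hex, fun i hi => subsingleton_ext_of_linearEquiv i
      (LinearEquiv.ofInjective (barD x N 0) ((injective_iff_map_eq_zero _).2 hex)) (hC 0 i hi)⟩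
  | succ k ih =>
    obtain ⟨-, ih⟩ := ih (by omega)
    have hex : BarExactAt x N (k + 1) := by
      intro c hc
      have hQ : Subsingleton
          (ModExt R (R ⧸ I) (((Fin (k + 1) → ι) → N) ⧸ LinearMap.range (barD x N k)) 0) :=
        subsingleton_ext_right (Submodule.injective_subtype (LinearMap.range (barD x N k)))
          (Submodule.mkQ_surjective _) (LinearMap.exact_subtype_mkQ _) 0 (hC _ _ (by omega))
          (ih 1 (by omega))
      refine (Submodule.Quotient.mk_eq_zero _).1 (eq_zero_of_forall_smul_eq_zero hQ _ ?_)
      intro r hr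
      rw [← Submodule.Quotient.mk_smul, Submodule.Quotient.mk_eq_zero]
      exact smul_mem_range_barD x k c hc (hI hr)
    refine ⟨hex, fun i hi => ?_⟩
    refine subsingleton_ext_right (f := (LinearMap.range (barD x N k)).subtype)
      (Submodule.injective_subtype _) (barD x N (k + 1)).surjective_rangeRestrict ?_ i
      (hC _ _ (by omega)) (ih (i + 1) (by omega))
    intro c
    rw [← Submodule.coe_eq_zero, LinearMap.codRestrict_apply]
    refine ⟨fun hc => ?_, ?_⟩
    · obtain ⟨b, rfl⟩ := hex c hc
      exact ⟨⟨_, b, rfl⟩, rfl⟩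
    · rintro ⟨⟨_, b, rfl⟩, rfl⟩
      exact barD_barD x k b

end Complex

section Split

variable {S : Type u} [CommRing S]

lemma exists_fg_maximal_extension {E : Type*} [AddCommGroup E] [Module S E] [Module.Finite S E]
    (N : Submodule S E) (hN : N.FG) (hN' : N ≠ ⊤) :
    ∃ (N' : Submodule S E) (e : E), N ≤ N' ∧ N'.FG ∧ e ∉ N' ∧ N' ⊔ Submodule.span S {e} = ⊤ := by
  classical
  obtain ⟨s, hs⟩ := Module.Finite.fg_top (R := S) (M := E)
  have hne : (s.powerset.filter fun t : Finset E => N ⊔ Submodule.span S (t : Set E) ≠ ⊤).Nonempty :=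
    ⟨∅, by simpa using hN'⟩
  obtain ⟨t, ht, hmax⟩ := Finset.exists_max_image _ Finset.card hne
  simp only [Finset.mem_filter, Finset.mem_powerset] at ht hmax
  obtain ⟨e, hes, het⟩ : ∃ e ∈ s, e ∉ N ⊔ Submodule.span S (t : Set E) := by
    by_contra! h
    exact ht.2 (top_le_iff.1 (hs ▸ Submodule.span_le.2 fun e he => h e he))
  refine ⟨_, e, le_sup_left, hN.sup ⟨t, rfl⟩, het, ?_⟩
  by_contra hcon
  have hnot : e ∉ t := fun h => het (Submodule.mem_sup_right (Submodule.subset_span h))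
  have := hmax (insert e t) ⟨Finset.insert_subset hes ht.1, by
    rw [Finset.coe_insert, Set.insert_eq, Submodule.span_union, sup_comm (Submodule.span S {e}),
      ← sup_assoc]
    exact hcon⟩
  rw [Finset.card_insert_of_notMem hnot] at this
  omega

variable {P Q : Type u} [AddCommGroup P] [Module S P] [AddCommGroup Q] [Module S Q]

lemma exists_dual_basis [Module.Finite S P] [Module.Projective S P] :
    ∃ (n : ℕ) (p : Fin n → P) (l : Fin n → Module.Dual S P), ∀ y, ∑ i, l i y • p i = y := by
  obtain ⟨n, f, g, -, -, hfg⟩ := Module.Finite.exists_comp_eq_id_of_projective S P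
  refine ⟨n, fun i => f (Pi.single i 1), fun i => LinearMap.proj i ∘ₗ g, fun y => ?_⟩
  have h : ∑ i, g y i • Pi.single (M := fun _ => S) i 1 = g y := by
    ext j
    simp [Finset.sum_apply, Pi.single_apply]
  calc _ = f (∑ i, g y i • Pi.single (M := fun _ => S) i 1) := by simp [map_sum]
    _ = y := by rw [h]; exact LinearMap.congr_fun hfg y

lemma exists_leftInverse_of_dualMap_surjective [Module.Finite S P] [Module.Projective S P]
    (φ : P →ₗ[S] Q) (h : Function.Surjective φ.dualMap) :
    ∃ ψ : Q →ₗ[S] P, ψ ∘ₗ φ = LinearMap.id := by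
  obtain ⟨n, p, l, hpl⟩ := exists_dual_basis (S := S) (P := P)
  choose μ hμ using fun i => h (l i)
  refine ⟨∑ i, (μ i).smulRight (p i), LinearMap.ext fun y => ?_⟩
  have h' (i : Fin n) : μ i (φ y) = l i y := LinearMap.congr_fun (hμ i) y
  simp [h', hpl]

/-- If a map `φ : P → Q` of finitely generated projective modules does not split, then modulo some
proper finitely generated ideal `I` there is a unimodular element `v` of `P` killed by `φ`. -/
lemma exists_unimodular_of_not_split [Module.Finite S P] [Module.Projective S P]
    [Module.Finite S Q] [Module.Projective S Q] (φ : P →ₗ[S] Q)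
    (h : ¬ ∃ ψ : Q →ₗ[S] P, ψ ∘ₗ φ = LinearMap.id) :
    ∃ (I : Ideal S) (v : P) (l : Module.Dual S P), I.FG ∧ I ≠ ⊤ ∧ l v - 1 ∈ I ∧
      ∀ μ : Module.Dual S Q, μ (φ v) ∈ I := by
  have hN : LinearMap.range φ.dualMap ≠ ⊤ := fun H =>
    h (exists_leftInverse_of_dualMap_surjective φ (LinearMap.range_eq_top.1 H))
  have hNfg : (LinearMap.range φ.dualMap).FG := by
    rw [LinearMap.range_eq_map]
    exact Module.Finite.fg_top.map _
  obtain ⟨N, l, hle, hfg, hl, hsup⟩ := exists_fg_maximal_extension _ hNfg hN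
  let q : S →ₗ[S] (Module.Dual S P ⧸ N) := LinearMap.toSpanSingleton S _ (N.mkQ l)
  have hq (s : S) : q s = N.mkQ (s • l) := by simp [q]
  have hqs : Function.Surjective q := by
    intro y
    obtain ⟨m, rfl⟩ := N.mkQ_surjective y
    obtain ⟨n, hn, z, hz, rfl⟩ := Submodule.mem_sup.1 (hsup ▸ Submodule.mem_top : m ∈ _)
    obtain ⟨s, rfl⟩ := Submodule.mem_span_singleton.1 hz
    have hn' : N.mkQ n = 0 := (Submodule.Quotient.mk_eq_zero N).2 hn
    exact ⟨s, by rw [hq, map_add, hn', zero_add]⟩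
  have hfp : Module.FinitePresentation S (Module.Dual S P ⧸ N) := by
    have := Module.finitePresentation_of_projective S (Module.Dual S P)
    exact Module.finitePresentation_of_surjective N.mkQ N.mkQ_surjective (by simpa using hfg)
  obtain ⟨f, hf⟩ := Module.projective_lifting_property q N.mkQ hqs
  have hf' (m : Module.Dual S P) : q (f m) = N.mkQ m := LinearMap.congr_fun hf m
  obtain ⟨v, hv⟩ := (Module.evalEquiv S P).surjective f
  have hfv (m : Module.Dual S P) : m v = f m := by rw [← hv]; rfl
  refine ⟨LinearMap.ker q, v, l, Module.FinitePresentation.fg_ker q hqs, ?_, ?_, fun μ => ?_⟩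
  · intro H
    refine hl ((Submodule.Quotient.mk_eq_zero N).1 ?_)
    have : q 1 = 0 := by
      rw [← LinearMap.mem_ker, H]
      trivial
    simpa [hq] using this
  · rw [LinearMap.mem_ker, map_sub, hfv, hf', hq, one_smul, sub_self]
  · rw [LinearMap.mem_ker]
    have : μ (φ v) = f (φ.dualMap μ) := hfv (φ.dualMap μ)
    rw [this, hf']
    exact (Submodule.Quotient.mk_eq_zero N).2 (hle ⟨μ, rfl⟩)

end Split

section Resolution

variable {S : Type u} [CommRing S]

lemma exists_retraction_iff_exists_section {N₁ N₂ N₃ : Type u} [AddCommGroup N₁] [Module S N₁]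
    [AddCommGroup N₂] [Module S N₂] [AddCommGroup N₃] [Module S N₃] {f : N₁ →ₗ[S] N₂}
    {g : N₂ →ₗ[S] N₃} (hf : Function.Injective f) (hg : Function.Surjective g)
    (hfg : Function.Exact f g) :
    (∃ r : N₂ →ₗ[S] N₁, r ∘ₗ f = LinearMap.id) ↔ ∃ s : N₃ →ₗ[S] N₂, g ∘ₗ s = LinearMap.id :=
  (hfg.split_tfae hf hg).out 1 0

lemma HasFPRLen.of_linearEquiv {n : ℕ} {X Y : Type u} [AddCommGroup X] [Module S X]
    [AddCommGroup Y] [Module S Y] (e : X ≃ₗ[S] Y) (h : HasFPRLen S n X) : HasFPRLen S n Y := by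
  cases n with
  | zero =>
    obtain ⟨h₁, h₂⟩ := h
    exact ⟨Module.Finite.equiv e, Module.Projective.of_equiv e⟩
  | succ n =>
    obtain ⟨P, _, _, f, h₁, h₂, hf, hker⟩ := h
    refine ⟨P, _, _, e.toLinearMap ∘ₗ f, h₁, h₂, e.surjective.comp hf, ?_⟩
    rw [LinearEquiv.ker_comp]
    exact hker

lemma HasFPRLen.hasProjResLE {n : ℕ} {X : Type u} [AddCommGroup X] [Module S X]
    (h : HasFPRLen S n X) : HasProjResLE S n X := by
  induction n generalizing X with
  | zero => exact h.2
  | succ n ih =>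
    obtain ⟨P, _, _, f, _, h₂, hf, hker⟩ := h
    exact ⟨P, _, _, f, h₂, hf, ih hker⟩

lemma hasProjectiveDimensionLT_of_projective (X : Type u) [AddCommGroup X] [Module S X]
    (h : Module.Projective S X) (n : ℕ) :
    HasProjectiveDimensionLT (ModuleCat.of S X) (n + 1) := by
  have := (IsProjective.iff_projective X).1 h
  exact hasProjectiveDimensionLT_of_ge _ 1 _ (by omega)

lemma HasProjResLE.hasProjectiveDimensionLT {n : ℕ} {X : Type u} [AddCommGroup X] [Module S X]
    (h : HasProjResLE S n X) : HasProjectiveDimensionLT (ModuleCat.of S X) (n + 1) := by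
  induction n generalizing X with
  | zero => exact hasProjectiveDimensionLT_of_projective X h 0
  | succ n ih =>
    obtain ⟨P, _, _, f, h₂, hf, hker⟩ := h
    have hS := shortExact_moduleCatMk (LinearMap.ker f).subtype_injective hf
      (LinearMap.exact_subtype_ker_map f)
    exact hS.hasProjectiveDimensionLT_X₃ (n + 1) (ih hker)
      (hasProjectiveDimensionLT_of_projective P h₂ (n + 1))

lemma le_projDim {n : ℕ} {X : Type u} [AddCommGroup X] [Module S X]
    (h : ¬ HasProjectiveDimensionLT (ModuleCat.of S X) n) : (n : ℕ∞) ≤ projDim S X := by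
  refine le_sInf ?_
  rintro _ ⟨m, rfl, hm⟩
  by_contra! hlt
  have := hm.hasProjectiveDimensionLT
  exact h (hasProjectiveDimensionLT_of_ge _ (m + 1) _ (by exact_mod_cast hlt))

lemma HasFPRLen.projDim_le {n : ℕ} {X : Type u} [AddCommGroup X] [Module S X]
    (h : HasFPRLen S n X) : projDim S X ≤ n :=
  sInf_le ⟨n, rfl, h.hasProjResLE⟩

end Resolution

section LowerBound

variable {S : Type u} [CommRing S] {ι : Type} [Fintype ι]

/-- If the complex `barD x S` is exact in degree `k + 1`, the range of `barD x S (k + 1)` is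
isomorphic to its source modulo the range of `barD x S k`. -/
noncomputable def rangeBarDEquiv (x : ι → S) (k : ℕ) (h : BarExactAt x S (k + 1)) :
    ((((Fin (k + 1) → ι) → S) ⧸ LinearMap.range (barD x S k)) ≃ₗ[S]
      LinearMap.range (barD x S (k + 1))) :=
  (Submodule.quotEquivOfEq _ _ (le_antisymm
    (by rintro _ ⟨b, rfl⟩; exact barD_barD x k b) fun c hc => h c hc)).trans
    (barD x S (k + 1)).quotKerEquivRange

lemma hasFPRLen_coker_barD (x : ι → S) (k : ℕ) (h : ∀ j ≤ k, BarExactAt x S j) :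
    HasFPRLen S (k + 1) (((Fin (k + 1) → ι) → S) ⧸ LinearMap.range (barD x S k)) := by
  classical
  refine ⟨(Fin (k + 1) → ι) → S, _, _, Submodule.mkQ _, inferInstance, inferInstance,
    Submodule.mkQ_surjective _, ?_⟩
  rw [Submodule.ker_mkQ]
  induction k with
  | zero =>
    have hinj : Function.Injective (barD x S 0) := (injective_iff_map_eq_zero _).2 (h 0 le_rfl)
    refine HasFPRLen.of_linearEquiv (LinearEquiv.ofInjective _ hinj) ⟨?_, ?_⟩ <;> infer_instance
  | succ k ih =>
    refine HasFPRLen.of_linearEquiv (rangeBarDEquiv x k (h _ le_rfl))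
      ⟨(Fin (k + 1) → ι) → S, _, _, Submodule.mkQ _, inferInstance, inferInstance,
        Submodule.mkQ_surjective _, ?_⟩
    rw [Submodule.ker_mkQ]
    exact ih fun j hj => h j (by omega)

lemma not_hasProjectiveDimensionLT_coker_barD (x : ι → S) (hx : Ideal.span (Set.range x) ≠ ⊤)
    (k : ℕ) (h : ∀ j ≤ k, BarExactAt x S j) :
    ¬ HasProjectiveDimensionLT
      (ModuleCat.of S (((Fin (k + 1) → ι) → S) ⧸ LinearMap.range (barD x S k))) (k + 1) := by
  classical
  induction k with
  | zero =>
    intro hpd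
    have hinj : Function.Injective (barD x S 0) := (injective_iff_map_eq_zero _).2 (h 0 le_rfl)
    have hproj := (IsProjective.iff_projective
      (((Fin 1 → ι) → S) ⧸ LinearMap.range (barD x S 0))).2
      (projective_iff_hasProjectiveDimensionLT_one.2 hpd)
    obtain ⟨s, hs⟩ := Module.projective_lifting_property
      (LinearMap.range (barD x S 0)).mkQ LinearMap.id (Submodule.mkQ_surjective _)
    have hex : Function.Exact (barD x S 0) (LinearMap.range (barD x S 0)).mkQ :=
      LinearMap.exact_map_mkQ_range _
    obtain ⟨r, hr⟩ := (exists_retraction_iff_exists_section hinj (Submodule.mkQ_surjective _)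
      hex).2 ⟨s, hs⟩
    apply hx
    rw [Ideal.eq_top_iff_one]
    have h1 : r (barD x S 0 1) Fin.elim0 = 1 := by
      have := congrFun (LinearMap.congr_fun hr 1) Fin.elim0
      simpa using this
    rw [← h1, ← Finset.univ_sum_single (barD x S 0 1), map_sum, Finset.sum_apply]
    refine Ideal.sum_mem _ fun i _ => ?_
    have h2 : Pi.single i (barD x S 0 1 i) = x (i 0) • Pi.single (M := fun _ => S) i 1 := by
      rw [← Pi.single_smul, barD_zero_apply]
      simp
    rw [h2, map_smul, Pi.smul_apply, smul_eq_mul]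
    exact Ideal.mul_mem_right _ _ (Ideal.subset_span ⟨i 0, rfl⟩)
  | succ k ih =>
    intro hpd
    refine ih (fun j hj => h j (by omega)) ?_
    have hS := shortExact_moduleCatMk (LinearMap.range (barD x S (k + 1))).subtype_injective
      (Submodule.mkQ_surjective _) (LinearMap.exact_subtype_mkQ _)
    have h₁ : HasProjectiveDimensionLT (ModuleCat.of S (LinearMap.range (barD x S (k + 1))))
        (k + 1) :=
      hS.hasProjectiveDimensionLT_X₁ (k + 1)
        (hasProjectiveDimensionLT_of_projective ((Fin (k + 2) → ι) → S) inferInstance k) hpd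
    exact hasProjectiveDimensionLT_of_iso (rangeBarDEquiv x k (h _ le_rfl)).symm.toModuleIso _

theorem le_fPD_of_barExactAt (x : ι → S) (hx : Ideal.span (Set.range x) ≠ ⊤) (n : ℕ)
    (h : ∀ k < n, BarExactAt x S k) : (n : ℕ∞) ≤ fPD S := by
  cases n with
  | zero => simp
  | succ k =>
    have h' : ∀ j ≤ k, BarExactAt x S j := fun j hj => h j (by omega)
    refine (le_projDim (not_hasProjectiveDimensionLT_coker_barD x hx k h')).trans ?_
    exact le_iSup₂_of_le (ModuleCat.of S _) ⟨k + 1, hasFPRLen_coker_barD x k h'⟩ le_rfl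

end LowerBound

section UpperBound

variable {R S : Type u} [CommRing R] [CommRing S]

lemma map_ne_top_of_sq_zero (π : S →+* R) (hπ : Function.Surjective π)
    (hsq : ∀ s t, π s = 0 → π t = 0 → s * t = 0) {J : Ideal S} (hJ : J ≠ ⊤) : J.map π ≠ ⊤ := by
  intro h
  obtain ⟨j, hj, hj1⟩ := (Ideal.mem_map_iff_of_surjective π hπ).1
    ((Ideal.eq_top_iff_one _).1 h)
  have hz : π (1 - j) = 0 := by rw [map_sub, map_one, hj1, sub_self]
  refine hJ ((Ideal.eq_top_iff_one _).2 ?_)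
  have : (1 : S) = (1 + (1 - j)) * j := by linear_combination hsq _ _ hz hz
  rw [this]
  exact J.mul_mem_left _ hj

variable [Algebra R S]

lemma subsingleton_ext_of_finite_projective {A P : Type u} [AddCommGroup A] [Module R A]
    [AddCommGroup P] [Module S P] [Module R P] [IsScalarTower R S P] [Module.Finite S P]
    [Module.Projective S P] (k : ℕ) (h : Subsingleton (ModExt R A S k)) :
    Subsingleton (ModExt R A P k) := by
  obtain ⟨n, p, l, hpl⟩ := exists_dual_basis (S := S) (P := P)
  refine subsingleton_ext_of_sum_comp_eq_id k (fun _ : Fin n => S)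
    (fun i => (l i).restrictScalars R)
    (fun i => (LinearMap.toSpanSingleton S P (p i)).restrictScalars R) ?_ fun _ => h
  ext y
  simpa using hpl y

lemma extMap_mulLeft_eq_zero (π : S →+* R) (hπ : ∀ r, π (algebraMap R S r) = r) {I : Ideal R}
    {k : ℕ} {w : ModExt R (R ⧸ I) S k}
    (hw : ∀ t, π t = 0 → extMap (R ⧸ I) k (LinearMap.mulLeft R t) w = 0) {a : S} (ha : π a ∈ I) :
    extMap (R ⧸ I) k (LinearMap.mulLeft R a) w = 0 := by
  have h : LinearMap.mulLeft R a =
      π a • LinearMap.id + LinearMap.mulLeft R (a - algebraMap R S (π a)) := by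
    ext s
    simp [Algebra.smul_def, sub_mul]
  rw [h, extMap_add, extMap_smul_id, smul_ext_quotient_eq_zero I k ha, zero_add]
  exact hw _ (by rw [map_sub, hπ, sub_self])

lemma subsingleton_ext_of_unimodular (π : S →+* R) (hπ : ∀ r, π (algebraMap R S r) = r)
    (hsq : ∀ s t, π s = 0 → π t = 0 → s * t = 0)
    {P Q X : Type u} [AddCommGroup P] [Module S P] [Module R P] [IsScalarTower R S P]
    [AddCommGroup Q] [Module S Q] [Module R Q] [IsScalarTower R S Q]
    [AddCommGroup X] [Module S X] [Module R X] [IsScalarTower R S X]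
    [Module.Finite S Q] [Module.Projective S Q] {φ : P →ₗ[S] Q} {g : Q →ₗ[S] X}
    (hφ : Function.Injective φ) (hg : Function.Surjective g) (hφg : Function.Exact φ g)
    {J : Ideal S} {v : P} {l : Module.Dual S P} (hl : l v - 1 ∈ J)
    (hμ : ∀ μ : Module.Dual S Q, μ (φ v) ∈ J) (k : ℕ)
    (hX : ∀ j < k, Subsingleton (ModExt R (R ⧸ J.map π) X j)) :
    Subsingleton (ModExt R (R ⧸ J.map π) S k) := by
  have key (w : ModExt R (R ⧸ J.map π) S k)
      (hw : ∀ t, π t = 0 → extMap _ k (LinearMap.mulLeft R t) w = 0) : w = 0 := by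
    have hJ {a : S} (ha : a ∈ J) : extMap _ k (LinearMap.mulLeft R a) w = 0 :=
      extMap_mulLeft_eq_zero π hπ hw (Ideal.mem_map_of_mem π ha)
    obtain ⟨n, q, m, hqm⟩ := exists_dual_basis (S := S) (P := Q)
    let V : S →ₗ[R] P := (LinearMap.toSpanSingleton S P v).restrictScalars R
    have hφV : φ.restrictScalars R ∘ₗ V =
        ∑ i, (LinearMap.toSpanSingleton S Q (q i)).restrictScalars R ∘ₗ
          LinearMap.mulLeft R (m i (φ v)) := by
      ext s
      calc φ (s • v) = s • ∑ i, m i (φ v) • q i := by rw [map_smul, hqm]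
        _ = _ := by simp [Finset.smul_sum, smul_smul, mul_comm]
    have hVw : extMap _ k V w = 0 := by
      refine extMap_injective (f := φ.restrictScalars R) (g := g.restrictScalars R) hφ hg hφg k hX ?_
      rw [map_zero, ← extMap_comp, hφV, extMap_sum]
      refine Finset.sum_eq_zero fun i _ => ?_
      rw [extMap_comp, hJ (hμ (m i)), map_zero]
    have hlV : l.restrictScalars R ∘ₗ V = LinearMap.mulLeft R (l v - 1) + LinearMap.id := by
      ext s
      simp only [V, LinearMap.comp_apply, LinearMap.restrictScalars_apply,
        LinearMap.toSpanSingleton_apply, map_smul, smul_eq_mul, LinearMap.add_apply,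
        LinearMap.mulLeft_apply, LinearMap.id_apply]
      ring
    have h := extMap_comp k V (l.restrictScalars R) w
    rwa [hVw, map_zero, hlV, extMap_add, hJ hl, zero_add, extMap_id] at h
  refine subsingleton_of_forall_eq 0 fun w => key w fun t ht => key _ fun s hs => ?_
  rw [← extMap_comp]
  have : LinearMap.mulLeft R s ∘ₗ LinearMap.mulLeft R t = 0 := by
    ext y
    simp [← mul_assoc, hsq s t hs ht]
  rw [this, extMap_zero]

theorem exists_fg_ideal_of_hasFPRLen (π : S →+* R) (hπ : ∀ r, π (algebraMap R S r) = r)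
    (hsq : ∀ s t, π s = 0 → π t = 0 → s * t = 0) (n : ℕ) {X : Type u} [AddCommGroup X]
    [Module S X] [Module R X] [IsScalarTower R S X] (h : HasFPRLen S (n + 1) X)
    (h' : ¬ HasFPRLen S n X) :
    ∃ I : Ideal R, I.FG ∧ I ≠ ⊤ ∧ ∀ k, (∀ j < k, Subsingleton (ModExt R (R ⧸ I) S j)) →
      (∀ j, j + n < k → Subsingleton (ModExt R (R ⧸ I) X j)) →
        Subsingleton (ModExt R (R ⧸ I) S k) := by
  obtain ⟨P, _, _, f, _, _, hf, hker⟩ := h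
  let _ : Module R P := Module.compHom P (algebraMap R S)
  have : IsScalarTower R S P := IsScalarTower.of_algebraMap_smul fun _ _ => rfl
  induction n generalizing X P with
  | zero =>
    obtain ⟨_, _⟩ := hker
    have hns : ¬ ∃ ψ : P →ₗ[S] LinearMap.ker f, ψ ∘ₗ (LinearMap.ker f).subtype = LinearMap.id := by
      rw [exists_retraction_iff_exists_section (Submodule.subtype_injective _) hf
        (LinearMap.exact_subtype_ker_map f)]
      rintro ⟨s, hs⟩
      exact h' ⟨Module.Finite.of_surjective f hf, Module.Projective.of_split s f hs⟩
    obtain ⟨J, v, l, hfg, hJ, hl, hμ⟩ := exists_unimodular_of_not_split _ hns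
    refine ⟨J.map π, hfg.map π, map_ne_top_of_sq_zero π (fun r => ⟨_, hπ r⟩) hsq hJ,
      fun k _ hX => ?_⟩
    exact subsingleton_ext_of_unimodular π hπ hsq (Submodule.subtype_injective _) hf
      (LinearMap.exact_subtype_ker_map f) hl hμ k hX
  | succ n ih =>
    obtain ⟨P', _, _, f', _, _, hf', hker'⟩ := hker
    let _ : Module R P' := Module.compHom P' (algebraMap R S)
    have : IsScalarTower R S P' := IsScalarTower.of_algebraMap_smul fun _ _ => rfl
    obtain ⟨I, hfg, hI, H⟩ := ih (X := LinearMap.ker f)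
      (fun hK => h' ⟨P, _, _, f, inferInstance, inferInstance, hf, hK⟩)
      P' _ _ f' inferInstance inferInstance hf' hker' this
    refine ⟨I, hfg, hI, fun k hS hX => H k hS fun j hj => ?_⟩
    have hP : Subsingleton (ModExt R (R ⧸ I) P j) :=
      subsingleton_ext_of_finite_projective j (hS j (by omega))
    exact (extMap_injective (f := (LinearMap.ker f).subtype.restrictScalars R)
      (g := f.restrictScalars R) (Submodule.subtype_injective _) hf
      (LinearMap.exact_subtype_ker_map f) j fun i hi => hX i (by omega)).subsingleton

theorem exists_fg_ideal_of_hasFPRLen_minimal (π : S →+* R) (hπ : ∀ r, π (algebraMap R S r) = r)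
    (hsq : ∀ s t, π s = 0 → π t = 0 → s * t = 0) (n : ℕ) {X : Type u} [AddCommGroup X]
    [Module S X] (h : HasFPRLen S (n + 1) X) (h' : ¬ HasFPRLen S n X) :
    ∃ I : Ideal R, I.FG ∧ I ≠ ⊤ ∧ ∀ k ≤ n, Subsingleton (ModExt R (R ⧸ I) S k) := by
  let _ : Module R X := Module.compHom X (algebraMap R S)
  have : IsScalarTower R S X := IsScalarTower.of_algebraMap_smul fun _ _ => rfl
  obtain ⟨I, hfg, hI, H⟩ := exists_fg_ideal_of_hasFPRLen π hπ hsq n h h'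
  refine ⟨I, hfg, hI, fun k => ?_⟩
  induction k using Nat.strong_induction_on with
  | _ k ih => exact fun hk => H k (fun j hj => ih j hj (by omega)) fun j hj => by omega

end UpperBound

section Grade

variable {R : Type u} [CommRing R] {N : Type u} [AddCommGroup N] [Module R N]

lemma natCast_le_extGrade_iff {I : Ideal R} {n : ℕ} :
    (n : ℕ∞) ≤ extGrade R I N ↔ ∀ i < n, Subsingleton (ModExt R (R ⧸ I) N i) := by
  refine ⟨fun h i hi => ?_, fun h => le_sInf ?_⟩
  · by_contra hcon
    have hle : extGrade R I N ≤ i := sInf_le ⟨i, rfl, by rwa [subsingleton_extMod_iff]⟩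
    exact absurd (Nat.cast_le.1 (h.trans hle)) (by omega)
  · rintro _ ⟨p, rfl, hp⟩
    rw [subsingleton_extMod_iff] at hp
    by_contra! hlt
    exact hp (h p (by exact_mod_cast hlt))

lemma exists_fg_of_natCast_le_idealGrade {J : Ideal R} {n : ℕ}
    (h : (n : ℕ∞) ≤ idealGrade R J N) :
    ∃ I : Ideal R, I.FG ∧ I ≤ J ∧ ∀ i < n, Subsingleton (ModExt R (R ⧸ I) N i) := by
  simp only [← natCast_le_extGrade_iff]
  cases n with
  | zero => exact ⟨⊥, Submodule.fg_bot, bot_le, by simp⟩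
  | succ n =>
    by_contra! hcon
    have hle : idealGrade R J N ≤ n := iSup_le fun I => iSup₂_le fun hfg hI =>
      Order.le_of_lt_add_one (hcon I hfg hI)
    exact absurd (Nat.cast_le.1 (h.trans hle)) (by omega)

lemma natCast_le_idealGrade {I J : Ideal R} (hfg : I.FG) (hI : I ≤ J) {n : ℕ}
    (h : ∀ i < n, Subsingleton (ModExt R (R ⧸ I) N i)) : (n : ℕ∞) ≤ idealGrade R J N :=
  (natCast_le_extGrade_iff.2 h).trans (le_iSup_of_le I (le_iSup₂_of_le hfg hI le_rfl))

lemma BarExactAt.of_comp_add_comp_eq_id {ι : Type} {x : ι → R} {k : ℕ} {N₁ N₂ : Type u}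
    [AddCommGroup N₁] [Module R N₁] [AddCommGroup N₂] [Module R N₂] (f₁ : N →ₗ[R] N₁)
    (g₁ : N₁ →ₗ[R] N) (f₂ : N →ₗ[R] N₂) (g₂ : N₂ →ₗ[R] N) (h : ∀ y, g₁ (f₁ y) + g₂ (f₂ y) = y)
    (h₁ : BarExactAt x N₁ k) (h₂ : BarExactAt x N₂ k) : BarExactAt x N k := by
  have hz {N' : Type u} [AddCommGroup N'] [Module R N'] (f : N →ₗ[R] N') {k : ℕ}
      {c : (Fin k → ι) → N} (hc : barD x N k c = 0) : barD x N' k (f ∘ c) = 0 := by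
    rw [barD_comp, hc]
    ext
    simp
  cases k with
  | zero =>
    intro c hc
    ext i
    have e₁ : f₁ (c i) = 0 := congrFun (h₁ _ (hz f₁ hc)) i
    have e₂ : f₂ (c i) = 0 := congrFun (h₂ _ (hz f₂ hc)) i
    rw [← h (c i), e₁, e₂]
    simp
  | succ k =>
    intro c hc
    obtain ⟨b₁, hb₁⟩ := h₁ _ (hz f₁ hc)
    obtain ⟨b₂, hb₂⟩ := h₂ _ (hz f₂ hc)
    refine ⟨g₁ ∘ b₁ + g₂ ∘ b₂, ?_⟩
    rw [map_add, barD_comp, barD_comp, hb₁, hb₂]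
    ext i
    exact h (c i)

lemma BarExactAt.algebraMap {ι : Type} {S : Type u} [CommRing S] [Algebra R S] {x : ι → R} {k : ℕ}
    (h : BarExactAt x S k) : BarExactAt (fun i => algebraMap R S (x i)) S k := by
  cases k with
  | zero => exact fun c hc => h c (by rwa [barD_algebraMap] at hc)
  | succ k =>
    intro c hc
    rw [barD_algebraMap] at hc
    obtain ⟨b, hb⟩ := h c hc
    exact ⟨b, by rwa [barD_algebraMap]⟩

lemma exists_fin_span_range_eq {I : Ideal R} (hI : I.FG) :
    ∃ (d : ℕ) (x : Fin d → R), Ideal.span (Set.range x) = I :=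
  Submodule.fg_iff_exists_fin_generating_family.1 hI

lemma iSup_idealGrade_le_fPD :
    ⨆ (m : Ideal R) (_ : m.IsMaximal), idealGrade R m R ≤ fPD R := by
  refine iSup₂_le fun m hm => ENat.forall_natCast_le_iff_le.1 fun n hn => ?_
  obtain ⟨I, hfg, hI, h⟩ := exists_fg_of_natCast_le_idealGrade hn
  obtain ⟨d, x, rfl⟩ := exists_fin_span_range_eq hfg
  exact le_fPD_of_barExactAt x (fun H => hm.ne_top (top_le_iff.1 (H ▸ hI))) n
    fun k hk => (barExactAt_of_ext x le_rfl n h k hk).1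

end Grade

section TrivSqZeroExt

variable (R : Type u) [CommRing R] (M : Type u) [AddCommGroup M] [Module R M]

lemma iSup_min_idealGrade_le_fPD_trivSqZeroExt :
    ⨆ (m : Ideal R) (_ : m.IsMaximal), min (idealGrade R m R) (idealGrade R m M) ≤
      fPD (TrivSqZeroExt R M) := by
  refine iSup₂_le fun m hm => ENat.forall_natCast_le_iff_le.1 fun n hn => ?_
  rw [le_min_iff] at hn
  obtain ⟨I₁, hfg₁, hI₁, h₁⟩ := exists_fg_of_natCast_le_idealGrade hn.1
  obtain ⟨I₂, hfg₂, hI₂, h₂⟩ := exists_fg_of_natCast_le_idealGrade hn.2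
  obtain ⟨d, x, hx⟩ := exists_fin_span_range_eq (Submodule.FG.sup hfg₁ hfg₂)
  refine le_fPD_of_barExactAt (fun i => algebraMap R (TrivSqZeroExt R M) (x i)) ?_ n fun k hk =>
    BarExactAt.algebraMap ?_
  · intro H
    have hmap : (Ideal.span (Set.range x)).map (algebraMap R (TrivSqZeroExt R M)) = ⊤ := by
      rw [Ideal.map_span, ← Set.range_comp]
      exact H
    have hcomp : (TrivSqZeroExt.fstHom R R M).toRingHom.comp
        (algebraMap R (TrivSqZeroExt R M)) = RingHom.id R := by
      ext r
      simp
    have htop := congrArg (Ideal.map (TrivSqZeroExt.fstHom R R M).toRingHom) hmap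
    rw [Ideal.map_map, hcomp, Ideal.map_id, Ideal.map_top, hx] at htop
    exact hm.ne_top (top_le_iff.1 (htop ▸ sup_le hI₁ hI₂))
  · exact BarExactAt.of_comp_add_comp_eq_id (TrivSqZeroExt.fstHom R R M).toLinearMap
      (TrivSqZeroExt.inlAlgHom R R M).toLinearMap (TrivSqZeroExt.sndHom R M)
      (TrivSqZeroExt.inrHom R M) TrivSqZeroExt.inl_fst_add_inr_snd_eq
      (barExactAt_of_ext x (hx ▸ le_sup_left) n h₁ k hk).1
      (barExactAt_of_ext x (hx ▸ le_sup_right) n h₂ k hk).1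

lemma fPD_trivSqZeroExt_le_iSup_min_idealGrade :
    fPD (TrivSqZeroExt R M) ≤
      ⨆ (m : Ideal R) (_ : m.IsMaximal), min (idealGrade R m R) (idealGrade R m M) := by
  classical
  refine iSup₂_le fun X hX => ?_
  have hX' : ∃ n, HasFPRLen (TrivSqZeroExt R M) n X := hX
  refine (Nat.find_spec hX').projDim_le.trans ?_
  obtain hn | ⟨n, hn⟩ : Nat.find hX' = 0 ∨ ∃ n, Nat.find hX' = n + 1 :=
    Nat.eq_zero_or_eq_succ_pred _ |>.imp_right fun h => ⟨_, h⟩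
  · simp [hn]
  have hsq (s t : TrivSqZeroExt R M) (hs : TrivSqZeroExt.fstHom R R M s = 0)
      (ht : TrivSqZeroExt.fstHom R R M t = 0) : s * t = 0 := by
    rw [TrivSqZeroExt.fstHom_apply] at hs ht
    ext <;> simp [hs, ht]
  obtain ⟨I, hfg, hI, H⟩ := exists_fg_ideal_of_hasFPRLen_minimal
    (TrivSqZeroExt.fstHom R R M).toRingHom (fun r => by simp) hsq n (hn ▸ Nat.find_spec hX')
    (Nat.find_min hX' (by omega))
  obtain ⟨m, hm, hIm⟩ := I.exists_le_maximal hI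
  rw [hn]
  refine le_iSup₂_of_le m hm (le_min ?_ ?_)
  · refine natCast_le_idealGrade hfg hIm fun i hi => ?_
    refine subsingleton_ext_of_sum_comp_eq_id (ι := Unit) i (fun _ => TrivSqZeroExt R M)
      (fun _ => (TrivSqZeroExt.inlAlgHom R R M).toLinearMap)
      (fun _ => (TrivSqZeroExt.fstHom R R M).toLinearMap) ?_ fun _ => H i (by omega)
    ext
    simp
  · refine natCast_le_idealGrade hfg hIm fun i hi => ?_
    refine subsingleton_ext_of_sum_comp_eq_id (ι := Unit) i (fun _ => TrivSqZeroExt R M)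
      (fun _ => TrivSqZeroExt.inrHom R M) (fun _ => TrivSqZeroExt.sndHom R M) ?_
      fun _ => H i (by omega)
    ext
    simp

end TrivSqZeroExt

/-- `fPD (R(+)M)` equals the supremum over maximal ideals `𝔪` of
`min (grade_R(𝔪, R)) (grade_R(𝔪, M))`; consequently `fPD (R(+)M) ≤ fPD R`. -/
theorem fPD_trivSqZeroExt (R : Type u) [CommRing R] (M : Type u) [AddCommGroup M]
    [Module R M] :
    (fPD (TrivSqZeroExt R M) =
        ⨆ (m : Ideal R) (_ : m.IsMaximal), min (idealGrade R m R) (idealGrade R m M)) ∧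
      fPD (TrivSqZeroExt R M) ≤ fPD R := by
  have h := le_antisymm (fPD_trivSqZeroExt_le_iSup_min_idealGrade R M)
    (iSup_min_idealGrade_le_fPD_trivSqZeroExt R M)
  exact ⟨h, h.le.trans ((iSup₂_mono fun m _ => min_le_left _ _).trans iSup_idealGrade_le_fPD)⟩
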